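/- arXiv:1709.00448 — 2 statements merged into one kernel-verified Lean document; each statement's English description precedes it below -/
import Mathlib

section
/- Let k ≥ 0 and ν ≥ 0 be real numbers with k + ν > 0, and let 0 < s < 1. Then (k(k+2ν))^s = (k+ν)^{2s} + ((2ν)^{s+1/2} π^{1/2} / Γ(-s)) ∫_0^∞ e^{-t(k+ν)} B_{-s-1/2}(νt) t^{-(1/2+s)} dt, and the integral converges absolutely. -/
open MeasureTheory

/-- The modified Bessel function of the first kind `I_ρ(z)` minus the first term of its
Taylor expansion: `B_ρ(z) = ∑_{m=1}^∞ (z/2)^(2m+ρ)/(Γ(m+1)Γ(m+ρ+1))`. -/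
noncomputable def besselB (ρ z : ℝ) : ℝ :=
  ∑' m : ℕ, (z / 2) ^ (2 * ((m : ℝ) + 1) + ρ) /
    (Real.Gamma ((m : ℝ) + 2) * Real.Gamma ((m : ℝ) + 1 + ρ + 1))

open Filter Topology in
lemma choose_gamma (s : ℝ) (hs0 : 0 < s) (hs1 : s < 1) (n : ℕ) :
    Ring.choose s n * (-1) ^ n = Real.Gamma (n - s) / (Real.Gamma (-s) * Real.Gamma (n + 1)) := by
  have hG : Real.Gamma (-s) ≠ 0 := by
    apply Real.Gamma_ne_zero
    intro m hm
    have h1 : s = m := by linarith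
    rw [h1] at hs0 hs1
    have h2 : 0 < m := by exact_mod_cast hs0
    have h3 : m < 1 := by exact_mod_cast hs1
    omega
  induction n with
  | zero => simp [hG]
  | succ n ih =>
    have hne : (n : ℝ) - s ≠ 0 := by
      intro h
      have h1 : s = n := by linarith
      rw [h1] at hs0 hs1
      have h2 : 0 < n := by exact_mod_cast hs0
      have h3 : n < 1 := by exact_mod_cast hs1
      omega
    have hn1 : (n : ℝ) + 1 ≠ 0 := by positivity
    have hrec : Ring.choose s (n + 1) = Ring.choose s n * (s - n) / (n + 1) := by
      rw [Ring.choose_eq_smul, Ring.choose_eq_smul, descPochhammer_succ_right,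
        Polynomial.smeval_mul, Polynomial.smeval_sub, Polynomial.smeval_X,
        Polynomial.smeval_natCast, Nat.factorial_succ]
      have : (n.factorial : ℝ) ≠ 0 := by positivity
      simp only [smul_eq_mul, pow_one, pow_zero, nsmul_eq_mul, mul_one]
      push_cast
      field_simp
    have hg1 : Real.Gamma ((n + 1 : ℕ) - s) = (n - s) * Real.Gamma (n - s) := by
      rw [← Real.Gamma_add_one hne]; congr 1; push_cast; ring
    have hg2 : Real.Gamma ((n + 1 : ℕ) + 1) = (n + 1) * Real.Gamma (n + 1) := by
      rw [← Real.Gamma_add_one hn1]; congr 1; push_cast; ring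
    have hg3 : Real.Gamma ((n : ℝ) + 1) ≠ 0 := (Real.Gamma_pos_of_pos (by positivity)).ne'
    rw [hrec, hg1, hg2, pow_succ]
    calc _ = (Ring.choose s n * (-1) ^ n) * ((n - s) / (n + 1)) := by ring
      _ = _ := by rw [ih]; field_simp

lemma gamma_neg_neg (s : ℝ) (hs0 : 0 < s) (hs1 : s < 1) : Real.Gamma (-s) < 0 := by
  have h := Real.Gamma_add_one (s := -s) (by linarith)
  have h2 : 0 < Real.Gamma (-s + 1) := Real.Gamma_pos_of_pos (by linarith)
  rw [h] at h2
  nlinarith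

/-- The coefficients of `(1 - x) ^ s`. -/
noncomputable def cf (s : ℝ) (n : ℕ) : ℝ :=
  Real.Gamma (n - s) / (Real.Gamma (-s) * Real.Gamma (n + 1))

lemma cf_hasSum_lt (s : ℝ) (hs0 : 0 < s) (hs1 : s < 1) (x : ℝ) (hx0 : 0 ≤ x) (hx1 : x < 1) :
    HasSum (fun n => cf s n * x ^ n) ((1 - x) ^ s) := by
  have h := (Real.one_add_rpow_hasFPowerSeriesOnBall_zero (a := s)).hasSum (y := -x) (by
    simp [Metric.mem_eball, edist_eq_enorm_sub, enorm_eq_nnnorm]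
    rw [← NNReal.coe_lt_coe]; simpa [abs_of_nonneg hx0] using hx1)
  simp only [binomialSeries_apply, zero_add, List.ofFn_const, List.prod_replicate,
    smul_eq_mul] at h
  have e : (fun n => cf s n * x ^ n) = fun n => Ring.choose s n * (-x) ^ n := by
    funext n
    rw [cf, ← choose_gamma s hs0 hs1, neg_pow x]; ring
  rw [e, sub_eq_add_neg]
  exact h

lemma cf_zero (s : ℝ) (hs0 : 0 < s) (hs1 : s < 1) : cf s 0 = 1 := by
  simp [cf, (gamma_neg_neg s hs0 hs1).ne]

lemma cf_succ_neg (s : ℝ) (hs0 : 0 < s) (hs1 : s < 1) (n : ℕ) : cf s (n + 1) < 0 := by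
  have h1 : 0 < Real.Gamma ((n + 1 : ℕ) - s) :=
    Real.Gamma_pos_of_pos (by push_cast; linarith [Nat.cast_nonneg (α := ℝ) n])
  have h2 : 0 < Real.Gamma ((n + 1 : ℕ) + 1) := Real.Gamma_pos_of_pos (by positivity)
  exact div_neg_of_pos_of_neg h1 (mul_neg_of_neg_of_pos (gamma_neg_neg s hs0 hs1) h2)

lemma cf_hasSum_lt' (s : ℝ) (hs0 : 0 < s) (hs1 : s < 1) (x : ℝ) (hx0 : 0 ≤ x) (hx1 : x < 1) :
    HasSum (fun n => -cf s (n + 1) * x ^ (n + 1)) (1 - (1 - x) ^ s) := by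
  have h := (hasSum_nat_add_iff' 1).2 (cf_hasSum_lt s hs0 hs1 x hx0 hx1)
  simp only [Finset.sum_range_one, cf_zero s hs0 hs1, pow_zero, mul_one] at h
  have e : (fun n => -cf s (n + 1) * x ^ (n + 1)) = fun n => -(cf s (n + 1) * x ^ (n + 1)) := by
    funext n; ring
  rw [e, show 1 - (1 - x) ^ s = -((1 - x) ^ s - 1) by ring]
  exact h.neg

open Filter Topology in
lemma cf_summable (s : ℝ) (hs0 : 0 < s) (hs1 : s < 1) : Summable (cf s) := by
  rw [← summable_nat_add_iff 1, ← summable_neg_iff]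
  apply summable_of_sum_range_le (c := 1)
  · intro n; simpa using (cf_succ_neg s hs0 hs1 n).le
  intro N
  have ht : Tendsto (fun x : ℝ => ∑ n ∈ Finset.range N, -cf s (n + 1) * x ^ (n + 1)) (𝓝[<] 1)
      (𝓝 (∑ n ∈ Finset.range N, -cf s (n + 1) * 1 ^ (n + 1))) := by
    apply Tendsto.mono_left _ nhdsWithin_le_nhds
    apply Continuous.tendsto (f := fun x : ℝ => ∑ n ∈ Finset.range N, -cf s (n + 1) * x ^ (n + 1))
    fun_prop
  simp only [one_pow, mul_one] at ht
  refine le_of_tendsto ht ?_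
  filter_upwards [Ioo_mem_nhdsLT (show (0 : ℝ) < 1 by norm_num)] with x hx
  refine (sum_le_hasSum _ (fun n _ => ?_) (cf_hasSum_lt' s hs0 hs1 x hx.1.le hx.2)).trans ?_
  · exact mul_nonneg (by simpa using (cf_succ_neg s hs0 hs1 n).le) (pow_nonneg hx.1.le _)
  · have : 0 ≤ (1 - x) ^ s := Real.rpow_nonneg (by linarith [hx.2]) _
    linarith

open Filter Topology in
lemma cf_hasSum (s : ℝ) (hs0 : 0 < s) (hs1 : s < 1) (x : ℝ) (hx0 : 0 ≤ x) (hx1 : x ≤ 1) :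
    HasSum (fun n => cf s n * x ^ n) ((1 - x) ^ s) := by
  rcases hx1.lt_or_eq with h | rfl
  · exact cf_hasSum_lt s hs0 hs1 x hx0 h
  have hS := (cf_summable s hs0 hs1).hasSum
  have h1 := Real.tendsto_tsum_powerSeries_nhdsWithin_lt hS.tendsto_sum_nat
  have h2 : Tendsto (fun x : ℝ => (1 - x) ^ s) (𝓝[<] 1) (𝓝 ((1 - 1) ^ s)) := by
    apply Tendsto.mono_left _ nhdsWithin_le_nhds
    have : Continuous (fun x : ℝ => (1 - x) ^ s) :=
      (continuous_const.sub continuous_id).rpow_const (fun _ => Or.inr hs0.le)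
    exact this.tendsto 1
  have h3 : (fun x : ℝ => ∑' n, cf s n * x ^ n) =ᶠ[𝓝[<] 1] fun x => (1 - x) ^ s := by
    filter_upwards [Ioo_mem_nhdsLT (show (0 : ℝ) < 1 by norm_num)] with x hx
    exact (cf_hasSum_lt s hs0 hs1 x hx.1.le hx.2).tsum_eq
  have h4 := tendsto_nhds_unique (h1.congr' h3) h2
  rw [h4] at hS
  simpa using hS

lemma cf_hasSum' (s : ℝ) (hs0 : 0 < s) (hs1 : s < 1) (x : ℝ) (hx0 : 0 ≤ x) (hx1 : x ≤ 1) :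
    HasSum (fun n => cf s (n + 1) * x ^ (n + 1)) ((1 - x) ^ s - 1) := by
  have h := (hasSum_nat_add_iff' 1).2 (cf_hasSum s hs0 hs1 x hx0 hx1)
  simpa only [Finset.sum_range_one, cf_zero s hs0 hs1, pow_zero, mul_one] using h

/-- The terms of the integrand. -/
noncomputable def tm (a ν s : ℝ) (m : ℕ) (t : ℝ) : ℝ :=
  Real.exp (-t * a) * ((ν * t / 2) ^ (2 * ((m : ℝ) + 1) + (-s - 1/2)) /
    (Real.Gamma ((m : ℝ) + 2) * Real.Gamma ((m : ℝ) + 1 + (-s - 1/2) + 1))) * t ^ (-(1/2 + s))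

lemma tm_eq (a ν s : ℝ) (hν : 0 < ν) (m : ℕ) (t : ℝ) (ht : 0 < t) :
    tm a ν s m t = ((ν / 2) ^ (2 * (m : ℝ) + 3/2 - s) /
      (Real.Gamma ((m : ℝ) + 2) * Real.Gamma ((m : ℝ) + 1 - s + 1/2))) *
      (t ^ ((2 * ((m : ℝ) + 1 - s)) - 1) * Real.exp (-(a * t))) := by
  have e1 : (ν * t / 2) ^ (2 * ((m : ℝ) + 1) + (-s - 1/2)) =
      (ν / 2) ^ (2 * (m : ℝ) + 3/2 - s) * t ^ (2 * (m : ℝ) + 3/2 - s) := by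
    rw [← Real.mul_rpow (by positivity) ht.le]; congr 1 <;> ring
  have e2 : t ^ ((2 * ((m : ℝ) + 1 - s)) - 1) = t ^ (2 * (m : ℝ) + 3/2 - s) * t ^ (-(1/2 + s)) := by
    rw [← Real.rpow_add ht]; congr 1; ring
  rw [tm, e1, e2, show (m : ℝ) + 1 + (-s - 1/2) + 1 = (m : ℝ) + 1 - s + 1/2 by ring,
    show -t * a = -(a * t) by ring]
  ring

lemma tm_integrable (a ν s : ℝ) (ha : 0 < a) (hν : 0 < ν) (hs1 : s < 1) (m : ℕ) :
    IntegrableOn (tm a ν s m) (Set.Ioi 0) := by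
  refine IntegrableOn.congr_fun ?_ (fun t (ht : t ∈ Set.Ioi (0 : ℝ)) =>
    (tm_eq a ν s hν m t ht).symm) measurableSet_Ioi
  apply Integrable.const_mul
  have h := integrableOn_rpow_mul_exp_neg_mul_rpow (p := 1) (s := (2 * ((m : ℝ) + 1 - s)) - 1)
    (b := a) (by linarith [Nat.cast_nonneg (α := ℝ) m]) one_pos ha
  simpa [IntegrableOn] using h

lemma tm_integral (a ν s : ℝ) (ha : 0 < a) (hν : 0 < ν) (hs0 : 0 < s) (hs1 : s < 1) (m : ℕ) :
    ((2 * ν) ^ (s + 1/2) * Real.sqrt Real.pi / Real.Gamma (-s)) *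
      ∫ t in Set.Ioi (0 : ℝ), tm a ν s m t =
    a ^ (2 * s) * (cf s (m + 1) * ((ν / a) ^ 2) ^ (m + 1)) := by
  have hm := Nat.cast_nonneg (α := ℝ) m
  rw [setIntegral_congr_fun measurableSet_Ioi (fun t ht => tm_eq a ν s hν m t ht),
    integral_const_mul, Real.integral_rpow_mul_exp_neg_mul_Ioi (by linarith) ha, cf]
  have hd := Real.Gamma_mul_Gamma_add_half ((m : ℝ) + 1 - s)
  have hg1 : Real.Gamma ((m : ℝ) + 2) ≠ 0 := (Real.Gamma_pos_of_pos (by linarith)).ne'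
  have hg2 : Real.Gamma ((m : ℝ) + 1 - s + 1/2) ≠ 0 :=
    (Real.Gamma_pos_of_pos (by linarith)).ne'
  have hg3 := (gamma_neg_neg s hs0 hs1).ne
  have e1 : ((m + 1 : ℕ) : ℝ) - s = (m : ℝ) + 1 - s := by push_cast; ring
  have e2 : ((m + 1 : ℕ) : ℝ) + 1 = (m : ℝ) + 2 := by push_cast; ring
  rw [e1, e2]
  have p1 : (2 * ν) ^ (s + 1/2) = 2 ^ (s + 1/2) * ν ^ (s + 1/2) :=
    Real.mul_rpow (by norm_num) hν.le
  have p2 : (ν / 2) ^ (2 * (m : ℝ) + 3/2 - s) =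
      ν ^ (2 * (m : ℝ) + 3/2 - s) * 2 ^ (-(2 * (m : ℝ) + 3/2 - s)) := by
    rw [Real.div_rpow hν.le (by norm_num), Real.rpow_neg (by norm_num)]; rfl
  have p3 : (1 / a) ^ (2 * ((m : ℝ) + 1 - s)) = a ^ (-(2 * ((m : ℝ) + 1 - s))) := by
    rw [one_div, Real.inv_rpow ha.le, Real.rpow_neg ha.le]
  have p4 : ((ν / a) ^ 2) ^ (m + 1) = ν ^ (2 * (m : ℝ) + 2) * a ^ (-(2 * (m : ℝ) + 2)) := by
    rw [Real.rpow_neg ha.le, ← pow_mul, div_pow,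
      show (2 * (m : ℝ) + 2) = ((2 * (m + 1) : ℕ) : ℝ) by push_cast; ring,
      Real.rpow_natCast, Real.rpow_natCast]; rfl
  have q1 : ν ^ (2 * (m : ℝ) + 2) = ν ^ (s + 1/2) * ν ^ (2 * (m : ℝ) + 3/2 - s) := by
    rw [← Real.rpow_add hν]; congr 1; ring
  have q2 : a ^ (-(2 * ((m : ℝ) + 1 - s))) = a ^ (2 * s) * a ^ (-(2 * (m : ℝ) + 2)) := by
    rw [← Real.rpow_add ha]; congr 1; ring
  have q3 : (2 : ℝ) ^ (s + 1/2) * 2 ^ (-(2 * (m : ℝ) + 3/2 - s)) *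
      (2 ^ (1 - 2 * ((m : ℝ) + 1 - s)))⁻¹ = 1 := by
    rw [← Real.rpow_neg (by norm_num), ← Real.rpow_add (by norm_num),
      ← Real.rpow_add (by norm_num)]
    convert Real.rpow_zero 2 using 2; ring
  have r : (2 : ℝ) ^ (1 - 2 * ((m : ℝ) + 1 - s)) ≠ 0 := by positivity
  have hd' : Real.Gamma (2 * ((m : ℝ) + 1 - s)) * Real.sqrt Real.pi =
      Real.Gamma ((m : ℝ) + 1 - s) * Real.Gamma ((m : ℝ) + 1 - s + 1/2) *
      (2 ^ (1 - 2 * ((m : ℝ) + 1 - s)))⁻¹ := by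
    rw [hd]; field_simp
  rw [p1, p2, p3, p4, q1, q2]
  generalize ν ^ (s + 1/2) = X1 at *
  generalize ν ^ (2 * (m : ℝ) + 3/2 - s) = X2 at *
  generalize a ^ (2 * s) = X3 at *
  generalize a ^ (-(2 * (m : ℝ) + 2)) = X4 at *
  generalize (2 : ℝ) ^ (s + 1/2) = X5 at *
  generalize (2 : ℝ) ^ (-(2 * (m : ℝ) + 3/2 - s)) = X6 at *
  generalize ((2 : ℝ) ^ (1 - 2 * ((m : ℝ) + 1 - s)))⁻¹ = X7 at *
  generalize Real.Gamma ((m : ℝ) + 1 - s + 1/2) = G1 at *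
  generalize Real.Gamma ((m : ℝ) + 2) = G2 at *
  generalize Real.Gamma (-s) = G3 at *
  generalize Real.Gamma ((m : ℝ) + 1 - s) = G4 at *
  generalize Real.Gamma (2 * ((m : ℝ) + 1 - s)) = G5 at *
  calc _ = X1 * X2 * X3 * X4 * X5 * X6 * (G5 * Real.sqrt Real.pi) / (G1 * G2 * G3) := by
        field_simp
    _ = X1 * X2 * X3 * X4 * (X5 * X6 * X7) * (G4 * G1) / (G1 * G2 * G3) := by rw [hd']; ring
    _ = _ := by rw [q3]; field_simp

theorem stmt0 (k ν s : ℝ) (hk : 0 ≤ k) (hν : 0 ≤ ν) (hkν : 0 < k + ν)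
    (hs0 : 0 < s) (hs1 : s < 1) :
    IntegrableOn (fun t : ℝ =>
        Real.exp (-t * (k + ν)) * besselB (-s - 1/2) (ν * t) * t ^ (-(1/2 + s)))
      (Set.Ioi 0) ∧
    (k * (k + 2 * ν)) ^ s = (k + ν) ^ (2 * s) +
      ((2 * ν) ^ (s + 1/2) * Real.sqrt Real.pi / Real.Gamma (-s)) *
        ∫ t in Set.Ioi (0 : ℝ),
          Real.exp (-t * (k + ν)) * besselB (-s - 1/2) (ν * t) * t ^ (-(1/2 + s)) := by
  rcases hν.eq_or_lt with rfl | hν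
  · have hB : ∀ t : ℝ, besselB (-s - 1/2) (0 * t) = 0 := by
      intro t
      rw [besselB]
      convert tsum_zero with m
      rw [zero_mul, zero_div, Real.zero_rpow, zero_div]
      have := Nat.cast_nonneg (α := ℝ) m
      intro h; linarith
    simp only [hB]
    simp only [mul_zero, zero_mul, integral_zero, add_zero]
    refine ⟨integrableOn_zero, ?_⟩
    rw [Real.rpow_mul hk, Real.rpow_two, sq]
  set a := k + ν with ha
  have hF : (fun t : ℝ => Real.exp (-t * a) * besselB (-s - 1/2) (ν * t) * t ^ (-(1/2 + s))) =
      fun t => ∑' m, tm a ν s m t := by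
    funext t
    simp only [tm, besselB]
    rw [tsum_mul_right, tsum_mul_left]
  set C := (2 * ν) ^ (s + 1/2) * Real.sqrt Real.pi / Real.Gamma (-s) with hC
  have hC0 : C ≠ 0 := by
    have h1 : (2 * ν) ^ (s + 1/2) ≠ 0 := by positivity
    have h2 : Real.sqrt Real.pi ≠ 0 := by positivity
    exact div_ne_zero (mul_ne_zero h1 h2) (gamma_neg_neg s hs0 hs1).ne
  have hx1 : (ν / a) ^ 2 ≤ 1 := by
    have : ν / a ≤ 1 := (div_le_one hkν).2 (by linarith)
    exact pow_le_one₀ (by positivity) this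
  have hsum := (cf_hasSum' s hs0 hs1 ((ν / a) ^ 2) (by positivity) hx1).mul_left (a ^ (2 * s))
  have hint : ∀ m, ∫ t in Set.Ioi (0 : ℝ), tm a ν s m t =
      C⁻¹ * (a ^ (2 * s) * (cf s (m + 1) * ((ν / a) ^ 2) ^ (m + 1))) := by
    intro m
    rw [← tm_integral a ν s hkν hν hs0 hs1 m, ← hC, inv_mul_cancel_left₀ hC0]
  have hsum2 := hsum.mul_left C⁻¹
  simp only [← hint] at hsum2
  have hnorm : ∀ m, ∫ t in Set.Ioi (0 : ℝ), ‖tm a ν s m t‖ = ∫ t in Set.Ioi (0 : ℝ), tm a ν s m t := by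
    intro m
    refine setIntegral_congr_fun measurableSet_Ioi fun t ht => ?_
    have ht : 0 < t := ht
    have hm := Nat.cast_nonneg (α := ℝ) m
    have hg1 : 0 < Real.Gamma ((m : ℝ) + 2) := Real.Gamma_pos_of_pos (by linarith)
    have hg2 : 0 < Real.Gamma ((m : ℝ) + 1 - s + 1/2) := Real.Gamma_pos_of_pos (by linarith)
    refine Real.norm_of_nonneg ?_
    rw [tm_eq a ν s hν m t ht]
    positivity
  have hI := hasSum_integral_of_summable_integral_norm
    (fun m => tm_integrable a ν s hkν hν hs1 m) (by simpa only [hnorm] using hsum2.summable)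
  have hval := hI.unique hsum2
  rw [hF, hval]
  constructor
  · apply Integrable.of_integral_ne_zero
    rw [hval]
    have h1 : (1 - (ν / a) ^ 2) ^ s < 1 := by
      apply Real.rpow_lt_one (by linarith) _ hs0
      have : 0 < (ν / a) ^ 2 := by positivity
      linarith
    have h2 : a ^ (2 * s) ≠ 0 := by positivity
    exact mul_ne_zero (inv_ne_zero hC0) (mul_ne_zero h2 (by linarith))
  · rw [mul_inv_cancel_left₀ hC0]
    have : k * (k + 2 * ν) = a ^ 2 * (1 - (ν / a) ^ 2) := by
      have := hkν.ne'
      field_simp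
      rw [ha]; ring
    rw [this, Real.mul_rpow (by positivity) (by linarith), Real.rpow_mul hkν.le, Real.rpow_two]
    ring
end

section
/- Let 0 < σ < 2. There exist constants 0 < c ≤ C, depending only on σ, such that for all 0 < x < 1: c(x^{-1-σ} + (1-x)^{-1-σ}) ≤ ∫_0^∞ W_t(x) t^{-1-σ/2} dt ≤ C(x^{-1-σ} + (1-x)^{-1-σ}). -/
open MeasureTheory

/-- The heat kernel on the unit circle, identified with `[0,1]`:
`W_t(x) = 1 + 2 ∑_{k=1}^∞ e^{-4π²k²t} cos(2πkx)`. -/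
noncomputable def circleHeatKernel (t x : ℝ) : ℝ :=
  1 + 2 * ∑' k : ℕ, Real.exp (-4 * Real.pi ^ 2 * ((k : ℝ) + 1) ^ 2 * t) *
    Real.cos (2 * Real.pi * ((k : ℝ) + 1) * x)

lemma aux_int (s b : ℝ) (hs : 0 < s) (hb : 0 < b) :
    IntegrableOn (fun t : ℝ => t ^ (-1 - s) * Real.exp (-(b / t))) (Set.Ioi 0) ∧
    ∫ t in Set.Ioi (0 : ℝ), t ^ (-1 - s) * Real.exp (-(b / t)) = (1 / b) ^ s * Real.Gamma s := by
  have key := Real.integral_rpow_mul_exp_neg_mul_Ioi hs hb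
  have hG := Real.Gamma_pos_of_pos hs
  have hint : IntegrableOn (fun x : ℝ ↦ x ^ (s - 1) * Real.exp (-(b * x))) (Set.Ioi 0) :=
    .of_integral_ne_zero (by rw [key]; positivity)
  have hcong : Set.EqOn
      (fun x : ℝ => (|(-1 : ℝ)| * x ^ ((-1 : ℝ) - 1)) •
        ((fun y : ℝ ↦ y ^ (s - 1) * Real.exp (-(b * y))) (x ^ (-1 : ℝ))))
      (fun t : ℝ => t ^ (-1 - s) * Real.exp (-(b / t))) (Set.Ioi 0) := by
    intro x hx
    have hx : 0 < x := hx
    simp only [abs_neg, abs_one, one_mul, smul_eq_mul]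
    rw [← Real.rpow_mul hx.le, ← mul_assoc, ← Real.rpow_add hx, Real.rpow_neg_one, ← div_eq_mul_inv]
    congr 2
    ring
  constructor
  · exact ((integrableOn_Ioi_comp_rpow_iff _ (by norm_num : (-1 : ℝ) ≠ 0)).2 hint).congr_fun hcong
      measurableSet_Ioi
  · rw [← key, ← integral_comp_rpow_Ioi (fun y : ℝ ↦ y ^ (s - 1) * Real.exp (-(b * y)))
      (by norm_num : (-1 : ℝ) ≠ 0)]
    exact (setIntegral_congr_fun measurableSet_Ioi hcong).symm

lemma heat_eq (t x : ℝ) (ht : 0 < t) :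
    HasSum (fun n : ℤ => (4 * Real.pi) ^ (-(1 / 2) : ℝ) *
      (t ^ (-(1 / 2) : ℝ) * Real.exp (-(((n : ℝ) + x) ^ 2 / 4 / t)))) (circleHeatKernel t x) := by
  have hpi := Real.pi_pos
  have h1 := HurwitzZeta.hasSum_nat_cosKernel₀ x (t := 4 * Real.pi * t) (by positivity)
  have h2 : circleHeatKernel t x = HurwitzZeta.cosKernel x (4 * Real.pi * t) := by
    rw [circleHeatKernel, ← tsum_mul_left]
    have := h1.tsum_eq
    rw [← sub_add_cancel (HurwitzZeta.cosKernel x (4 * Real.pi * t)) 1, ← this, add_comm]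
    congr 1
    apply tsum_congr
    intro n
    rw [mul_comm (Real.exp _), ← mul_assoc]
    congr 2
    · congr 1
      ring
    · ring
  have h3 := HurwitzZeta.evenKernel_functional_equation x (1 / (4 * Real.pi * t))
  have h4 := HurwitzZeta.hasSum_int_evenKernel x (t := 1 / (4 * Real.pi * t)) (by positivity)
  have h5 := h4.mul_left ((4 * Real.pi * t) ^ (-(1 / 2) : ℝ))
  rw [h3, one_div_one_div, Real.div_rpow zero_le_one (by positivity), Real.one_rpow, one_div_one_div,
    ← mul_assoc, ← Real.rpow_add (by positivity), ← h2] at h5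
  norm_num at h5
  convert! h5 using 2 with n
  rw [← mul_assoc, ← Real.mul_rpow (by positivity) (by positivity)]
  congr 2
  field_simp

lemma main_sum (σ : ℝ) (h0 : 0 < σ) (x : ℝ) (hx0 : 0 < x) (hx1 : x < 1) :
    HasSum (fun n : ℤ => (4 * Real.pi) ^ (-(1 / 2) : ℝ) * 4 ^ ((1 + σ) / 2) *
      Real.Gamma ((1 + σ) / 2) * |(n : ℝ) + x| ^ (-1 - σ))
      (∫ t in Set.Ioi (0 : ℝ), circleHeatKernel t x * t ^ (-1 - σ / 2)) := by
  have hpi := Real.pi_pos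
  have hne : ∀ n : ℤ, (n : ℝ) + x ≠ 0 := by
    intro n h
    have h1 : (-1 : ℝ) < n := by linarith
    have h2 : (n : ℝ) < 0 := by linarith
    have h1' : (-1 : ℤ) < n := by exact_mod_cast h1
    have h2' : n < 0 := by exact_mod_cast h2
    omega
  set s := (1 + σ) / 2 with hs
  have hs0 : 0 < s := by positivity
  set K := (4 * Real.pi) ^ (-(1 / 2) : ℝ) with hK
  have hK0 : 0 < K := by positivity
  set F : ℤ → ℝ → ℝ := fun n t => K * (t ^ (-1 - s) * Real.exp (-(((n : ℝ) + x) ^ 2 / 4 / t)))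
    with hF
  have hb : ∀ n : ℤ, 0 < ((n : ℝ) + x) ^ 2 / 4 := fun n => by
    have := hne n
    positivity
  have hFint : ∀ n, Integrable (F n) (volume.restrict (Set.Ioi 0)) := fun n =>
    (aux_int s _ hs0 (hb n)).1.const_mul K
  have hval : ∀ n, ∫ t in Set.Ioi (0 : ℝ), F n t =
      K * 4 ^ s * Real.Gamma s * |(n : ℝ) + x| ^ (-1 - σ) := by
    intro n
    have ha : 0 < |(n : ℝ) + x| := abs_pos.2 (hne n)
    simp only [hF]
    rw [integral_const_mul, (aux_int s _ hs0 (hb n)).2, ← sq_abs, one_div_div,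
      Real.div_rpow (by norm_num) (by positivity), ← Real.rpow_natCast, ← Real.rpow_mul ha.le,
      show -1 - σ = -(((2 : ℕ) : ℝ) * s) by rw [hs]; push_cast; ring, Real.rpow_neg ha.le]
    field_simp
  have hnorm : ∀ n, ∫ t in Set.Ioi (0 : ℝ), ‖F n t‖ = ∫ t in Set.Ioi (0 : ℝ), F n t := by
    intro n
    refine setIntegral_congr_fun measurableSet_Ioi fun t ht => ?_
    have ht : 0 < t := ht
    exact Real.norm_of_nonneg (by simp only [hF]; positivity)
  have hsum : Summable fun n => ∫ t in Set.Ioi (0 : ℝ), ‖F n t‖ := by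
    simp only [hnorm, hval]
    apply Summable.mul_left
    have := (Real.summable_one_div_int_add_rpow x (1 + σ)).2 (by linarith)
    refine this.congr fun n => ?_
    rw [show -1 - σ = -(1 + σ) by ring, Real.rpow_neg (abs_nonneg _), one_div]
  have H := hasSum_integral_of_summable_integral_norm hFint hsum
  simp only [hval] at H
  convert! H using 1
  refine setIntegral_congr_fun measurableSet_Ioi fun t ht => ?_
  have ht : 0 < t := ht
  have := (heat_eq t x ht).mul_right (t ^ (-1 - σ / 2))
  rw [← this.tsum_eq]
  apply tsum_congr
  intro n
  simp only [hF]
  rw [show -1 - s = -(1 / 2) + (-1 - σ / 2) by rw [hs]; ring, Real.rpow_add ht]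
  ring

theorem stmt8 (σ : ℝ) (h0 : 0 < σ) (h2 : σ < 2) :
    ∃ c C : ℝ, 0 < c ∧ c ≤ C ∧ ∀ x : ℝ, 0 < x → x < 1 →
      (c * (x ^ (-1 - σ) + (1 - x) ^ (-1 - σ)) ≤
          ∫ t in Set.Ioi (0 : ℝ), circleHeatKernel t x * t ^ (-1 - σ / 2)) ∧
      (∫ t in Set.Ioi (0 : ℝ), circleHeatKernel t x * t ^ (-1 - σ / 2)) ≤
        C * (x ^ (-1 - σ) + (1 - x) ^ (-1 - σ)) := by
  have hpi := Real.pi_pos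
  have hG := Real.Gamma_pos_of_pos (show 0 < (1 + σ) / 2 by positivity)
  set A := (4 * Real.pi) ^ (-(1 / 2) : ℝ) * 4 ^ ((1 + σ) / 2) * Real.Gamma ((1 + σ) / 2) with hA
  have hA0 : 0 < A := by positivity
  have hS : Summable fun n : ℕ => ((n : ℝ) + 1) ^ (-1 - σ) := by
    have := (Real.summable_one_div_nat_add_rpow 1 (1 + σ)).2 (by linarith)
    refine this.congr fun n => ?_
    rw [show -1 - σ = -(1 + σ) by ring, Real.rpow_neg (by positivity), one_div,
      abs_of_nonneg (by positivity)]
  set S := ∑' n : ℕ, ((n : ℝ) + 1) ^ (-1 - σ) with hSdef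
  have hS0 : 0 ≤ S := tsum_nonneg fun n => by positivity
  refine ⟨A, A * (1 + S), hA0, by nlinarith, fun x hx0 hx1 => ?_⟩
  have hM := (main_sum σ h0 x hx0 hx1).nat_add_neg_add_one
  rw [← hA] at hM
  set I := ∫ t in Set.Ioi (0 : ℝ), circleHeatKernel t x * t ^ (-1 - σ / 2)
  have hM' : HasSum (fun n : ℕ => A * (((n : ℝ) + x) ^ (-1 - σ) + ((n : ℝ) + (1 - x)) ^ (-1 - σ)))
      I := by
    convert! hM using 2 with n
    have hn : (0 : ℝ) ≤ n := n.cast_nonneg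
    push_cast
    rw [abs_of_pos (by linarith), abs_of_neg (by linarith)]
    rw [show -(-((n : ℝ) + 1) + x) = n + (1 - x) by ring]
    ring
  have hx1' : 0 < 1 - x := by linarith
  constructor
  · have := le_hasSum hM' 0 (fun n _ => by positivity)
    simpa using this
  · have hT := (hasSum_nat_add_iff' 1).2 hM'
    have hle := hasSum_le (fun n : ℕ => ?_) hT
      (hS.hasSum.mul_right (A * (x ^ (-1 - σ) + (1 - x) ^ (-1 - σ))))
    · simp at hle
      rw [← hSdef] at hle
      linarith
    · have hn : (0 : ℝ) ≤ n := n.cast_nonneg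
      have e1 : ∀ y : ℝ, 0 < y → y < 1 → ((n + 1 : ℕ) + y) ^ (-1 - σ) ≤
          ((n : ℝ) + 1) ^ (-1 - σ) * y ^ (-1 - σ) := by
        intro y hy hy1
        rw [← Real.mul_rpow (by positivity) hy.le]
        apply Real.rpow_le_rpow_of_nonpos (by positivity) _ (by linarith)
        push_cast
        nlinarith
      have a1 := e1 x hx0 hx1
      have a2 := e1 (1 - x) hx1' (by linarith)
      calc _ ≤ A * (((n : ℝ) + 1) ^ (-1 - σ) * x ^ (-1 - σ) +
          ((n : ℝ) + 1) ^ (-1 - σ) * (1 - x) ^ (-1 - σ)) := by gcongr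
        _ = _ := by ring
end
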